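/- (Contiguous relation for the Andrews–Berkovich ₁₀φ₉ sums) Let q be a nonzero complex number, let n ≥ 1 be an integer, and let a, u be nonzero complex numbers with a ≠ 1 (write k = u²) such that all factors appearing in denominators below are nonzero: (q;q)_n ≠ 0, (u²q;q²)_{n+1} ≠ 0, (u²;q²)_{n+1} ≠ 0, (qu;q)_{n+1} ≠ 0, (−u;q)_{n+1} ≠ 0, (a²q²/u²;q)_{n+1} ≠ 0, (a²q/u²;q)_{n+1} ≠ 0, (a q^{-n+1}/u²;q)_{n+1} ≠ 0, (a q^{n−1};q)_{n+3} ≠ 0, 1 − u² ≠ 0, 1 − u²q ≠ 0, 1 − qu ≠ 0, and 1 − aq/u ≠ 0. Define A_n(a,u;q) := ∑_{j=0}^{n} ( (a;q)_j · ((1−aq^{2j})/(1−a)) · (a²q/u²;q²)_j (a²q²/u²;q²)_j (u²/(aq);q)_j (u²q^n;q)_j (q^{-n};q)_j / ((q;q)_j (u²q;q²)_j (u²;q²)_j (a²q²/u²;q)_j (a q^{-n+1}/u²;q)_j (a q^{n+1};q)_j) ) q^j and B_n(a,u;q) := ∑_{j=0}^{n} ( (a;q)_j · ((1−aq^{2j})/(1−a))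 · (a²q/u²;q²)_j (a/u;q)_j (−aq/u;q)_j (u²/a;q)_j (u²q^n;q)_j (q^{-n};q)_j / ((q;q)_j (u²q;q²)_j (qu;q)_j (−u;q)_j (a²q/u²;q)_j (a q^{-n+1}/u²;q)_j (a q^{n+1};q)_j) ) q^j. Then A_n(a,u;q) − B_n(a,u;q) = ψ_n(a,u;q) · B_{n−1}(aq², uq; q), where ψ_n(a,u;q) = q(1−aq)(1−aq²)(1−u²q^n)(1−q^{-n}) · (u − a²q/u² + a/u − u²/(aq)) / ((1−u²)(1−u²q)(1−qu)(1−aq/u)(1−a q^{-n+1}/u²)(1−aq^{n+1})), and B_{n−1}(aq²,uq;q) is B with a replaced by aq², u replaced by uq (i.e. k = u² replaced by kq²), and n replaced by n−1. -/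

import Mathlib

/-- The $q$-shifted factorial $(a;q)_m = \prod_{k=0}^{m-1}(1 - a q^k)$. -/
noncomputable def qPoch (q a : ℂ) (m : ℕ) : ℂ := ∏ k ∈ Finset.range m, (1 - a * q ^ k)

/-- The first Andrews–Berkovich ${}_{10}\phi_9$ sum $A_n(a,k;q)$, written with
$k = u^2$ in root-free very-well-poised form. -/
noncomputable def A10 (q a u : ℂ) (n : ℕ) : ℂ :=
  ∑ j ∈ Finset.range (n + 1),
    qPoch q a j * ((1 - a * q ^ (2 * j)) / (1 - a)) * qPoch (q ^ 2) (a ^ 2 * q / u ^ 2) j *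
      qPoch (q ^ 2) (a ^ 2 * q ^ 2 / u ^ 2) j * qPoch q (u ^ 2 / (a * q)) j *
      qPoch q (u ^ 2 * q ^ n) j * qPoch q (q ^ (-(n : ℤ))) j /
      (qPoch q q j * qPoch (q ^ 2) (u ^ 2 * q) j * qPoch (q ^ 2) (u ^ 2) j *
        qPoch q (a ^ 2 * q ^ 2 / u ^ 2) j * qPoch q (a * q ^ (1 - (n : ℤ)) / u ^ 2) j *
        qPoch q (a * q ^ (n + 1)) j) * q ^ j

/-- The second Andrews–Berkovich ${}_{10}\phi_9$ sum $B_n(a,k;q)$, written with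
$k = u^2$. -/
noncomputable def B10 (q a u : ℂ) (n : ℕ) : ℂ :=
  ∑ j ∈ Finset.range (n + 1),
    qPoch q a j * ((1 - a * q ^ (2 * j)) / (1 - a)) * qPoch (q ^ 2) (a ^ 2 * q / u ^ 2) j *
      qPoch q (a / u) j * qPoch q (-(a * q / u)) j * qPoch q (u ^ 2 / a) j *
      qPoch q (u ^ 2 * q ^ n) j * qPoch q (q ^ (-(n : ℤ))) j /
      (qPoch q q j * qPoch (q ^ 2) (u ^ 2 * q) j * qPoch q (q * u) j * qPoch q (-u) j *
        qPoch q (a ^ 2 * q / u ^ 2) j * qPoch q (a * q ^ (1 - (n : ℤ)) / u ^ 2) j *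
        qPoch q (a * q ^ (n + 1)) j) * q ^ j

lemma qPoch_succ (q a : ℂ) (m : ℕ) : qPoch q a (m + 1) = qPoch q a m * (1 - a * q ^ m) :=
  Finset.prod_range_succ _ _

lemma qPoch_succ_left (q a : ℂ) (m : ℕ) :
    qPoch q a (m + 1) = (1 - a) * qPoch q (a * q) m := by
  unfold qPoch
  rw [Finset.prod_range_succ', mul_comm]
  congr 1
  · simp
  · exact Finset.prod_congr rfl fun k _ => by ring

lemma qPoch_sq (q x : ℂ) (m : ℕ) :
    qPoch (q ^ 2) (x ^ 2) m = qPoch q x m * qPoch q (-x) m := by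
  unfold qPoch
  rw [← Finset.prod_mul_distrib]
  exact Finset.prod_congr rfl fun k _ => by ring

lemma one_sub_mul_pow_ne_zero {q a : ℂ} {N k : ℕ} (h : qPoch q a N ≠ 0) (hk : k < N) :
    1 - a * q ^ k ≠ 0 :=
  Finset.prod_ne_zero_iff.mp h k (Finset.mem_range.mpr hk)

/-- The factor `1 - a` cancels in the very-well-poised quotient of `(a;q)_m`, even when it
vanishes. -/
lemma one_sub_mul_qPoch_div (q a : ℂ) (m : ℕ) :
    (1 - a) * (qPoch q a m * ((1 - a * q ^ (2 * m)) / (1 - a)))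
      = qPoch q a m * (1 - a * q ^ (2 * m)) := by
  by_cases h : 1 - a = 0
  · cases m with
    | zero => simp [h]
    | succ m => simp [qPoch_succ_left, h]
  · field_simp

/-- Combination of two fractions with common factors, the polynomial content being the
hypothesis `hN`. -/
lemma sub_eq_of_common_factors
    {q X α R P S S₀ C₂ C₃ C₄ C₅ C₆ C₇ D₁ D₂ D₃ D₄ D₅ D₆ D₇ U W E₆ E₇ F₆ F₇ G G₁ G₂
      a₀ a₁ a₂ a₃ b₁ b₂ c₁ c₂ c₃ d₁ d₂ p₁ p₂ p₃ p₄ : ℂ}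
    (hα : α * a₃ = a₀ * a₁ * P) (hR : a₂ * R = P * S)
    (hU : U * p₂ = d₁ * d₂ * D₃) (hW : W * p₄ = c₁ * c₂ * D₅)
    (hN : b₁ * p₁ * G₁ * p₂ - p₃ * G₂ * d₁ * p₄ = G * S₀ * a₃)
    (ha₀ : a₀ ≠ 0) (hS₀ : S₀ ≠ 0) (hb₁ : b₁ ≠ 0) (hc₂ : c₂ ≠ 0)
    (hd₁ : d₁ ≠ 0) (hp₂ : p₂ ≠ 0) (hp₄ : p₄ ≠ 0) :
    α * (S / a₀) * (b₁ * C₂) * ((C₃ * p₁) * (c₂ * C₄)) * (G₁ * C₅) * (F₆ * C₆) * (F₇ * C₇) /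
        ((D₁ * S₀) * (b₂ * D₂) * (U * (c₃ * D₄)) * (W * p₄) * (E₆ * D₆) * (E₇ * D₇)) * (X * q) -
      α * (S / a₀) * (b₁ * C₂) * (p₃ * C₃) * (c₂ * C₄) * (C₅ * G₂) * (F₆ * C₆) * (F₇ * C₇) /
        ((D₁ * S₀) * (b₂ * D₂) * (d₂ * D₃) * (c₃ * D₄) * (b₁ * W) * (E₆ * D₆) * (E₇ * D₇)) *
          (X * q) =
    q * a₁ * a₂ * F₆ * F₇ * G / ((d₁ * c₃) * b₂ * d₂ * c₁ * E₆ * E₇) *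
      (R * C₂ * C₃ * C₄ * C₅ * C₆ * C₇ / (D₁ * D₂ * D₃ * D₄ * D₅ * D₆ * D₇) * X) := by
  have hU' : U⁻¹ = p₂ * (d₁⁻¹ * d₂⁻¹ * D₃⁻¹) := by
    rw [← mul_inv, ← mul_inv, ← hU, mul_inv, mul_left_comm, mul_inv_cancel₀ hp₂, mul_one]
  have hW' : W⁻¹ = p₄ * (c₁⁻¹ * c₂⁻¹ * D₅⁻¹) := by
    rw [← mul_inv, ← mul_inv, ← hW, mul_inv, mul_left_comm, mul_inv_cancel₀ hp₄, mul_one]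
  set K : ℂ := C₂ * C₃ * C₄ * C₅ * C₆ * C₇ * F₆ * F₇ * X * q *
    (a₀ * S₀ * b₂ * d₁ * c₃ * d₂ * c₁ * E₆ * E₇ * (D₁ * D₂ * D₃ * D₄ * D₅ * D₆ * D₇))⁻¹ with hK
  trans α * S * K * (b₁ * p₁ * G₁ * p₂ - p₃ * G₂ * d₁ * p₄)
  · rw [hW, mul_sub]
    congr 1
    · calc
        _ = α * S * K * (b₁ * p₁ * G₁ * p₂) * (c₂ * c₂⁻¹) := by
          simp only [hK, div_eq_mul_inv, mul_inv, hU']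
          ring
        _ = _ := by rw [mul_inv_cancel₀ hc₂, mul_one]
    · calc
        _ = α * S * (C₂ * C₃ * C₄ * C₅ * C₆ * C₇ * F₆ * F₇ * X * q *
            (a₀ * S₀ * b₂ * c₃ * d₂ * c₁ * E₆ * E₇ * (D₁ * D₂ * D₃ * D₄ * D₅ * D₆ * D₇))⁻¹) *
              (p₃ * G₂ * p₄) * (c₂ * c₂⁻¹) * (b₁ * b₁⁻¹) := by
          simp only [div_eq_mul_inv, mul_inv, hW']
          ring
        _ = α * S * (C₂ * C₃ * C₄ * C₅ * C₆ * C₇ * F₆ * F₇ * X * q *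
            (a₀ * S₀ * b₂ * c₃ * d₂ * c₁ * E₆ * E₇ * (D₁ * D₂ * D₃ * D₄ * D₅ * D₆ * D₇))⁻¹) *
              (p₃ * G₂ * p₄) * (d₁ * d₁⁻¹) := by
          rw [mul_inv_cancel₀ hc₂, mul_inv_cancel₀ hb₁, mul_inv_cancel₀ hd₁, mul_one]
        _ = _ := by
          simp only [hK, mul_inv]
          ring
  · calc
      _ = α * a₃ * S * (K * G * S₀) := by rw [hN]; ring
      _ = a₀ * a₁ * (a₂ * R) * (K * G * S₀) := by rw [hα, hR]; ring
      _ = q * a₁ * a₂ * F₆ * F₇ * G / ((d₁ * c₃) * b₂ * d₂ * c₁ * E₆ * E₇) *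
          (R * C₂ * C₃ * C₄ * C₅ * C₆ * C₇ / (D₁ * D₂ * D₃ * D₄ * D₅ * D₆ * D₇) * X) *
            (a₀ * a₀⁻¹) * (S₀ * S₀⁻¹) := by
        simp only [hK, div_eq_mul_inv, mul_inv]
        ring
      _ = _ := by rw [mul_inv_cancel₀ ha₀, mul_inv_cancel₀ hS₀, mul_one, mul_one]

/-- Rational-function identity behind the termwise contiguous relation, in the variables
`r = a / u` and `X = q ^ j`; the remaining letters stand for shifted factorials. -/
lemma sub_eq_mul_shifted_term {q r u X α R P C₂ C₃ C₄ C₅ C₆ C₇ 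
    D₁ D₂ D₃ D₄ D₅ D₆ D₇ U W E₆ E₇ F₆ F₇ : ℂ}
    (hq : q ≠ 0) (hr : r ≠ 0) (ha : 1 - r * u ≠ 0)
    (hα : α * (1 - r * u * q * X) = (1 - r * u) * (1 - r * u * q) * P)
    (hR : (1 - r * u * q ^ 2) * R = P * (1 - r * u * q ^ 2 * X ^ 2))
    (hU : U * (1 - u * q * X) = (1 - u) * (1 - q * u) * D₃)
    (hW : W * (1 - r ^ 2 * q ^ 2 * X) = (1 - r ^ 2 * q ^ 2) * D₅)
    (hqX : 1 - q * X ≠ 0) (hu1 : 1 - u ≠ 0) (hrq' : 1 + r * q ≠ 0)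
    (hr2 : 1 - r ^ 2 * q ≠ 0) (hr2X : 1 - r ^ 2 * q ^ 2 * X ≠ 0) (huX : 1 - u * q * X ≠ 0) :
    α * ((1 - r * u * q ^ 2 * X ^ 2) / (1 - r * u)) * ((1 - r ^ 2 * q) * C₂) *
          ((C₃ * (1 - r * q * X)) * ((1 + r * q) * C₄)) * ((1 - u / (r * q)) * C₅) *
          (F₆ * C₆) * (F₇ * C₇) /
        ((D₁ * (1 - q * X)) * ((1 - u ^ 2 * q) * D₂) * (U * ((1 + u) * D₄)) *
          (W * (1 - r ^ 2 * q ^ 2 * X)) * (E₆ * D₆) * (E₇ * D₇)) * (X * q) -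
      α * ((1 - r * u * q ^ 2 * X ^ 2) / (1 - r * u)) * ((1 - r ^ 2 * q) * C₂) *
          ((1 - r) * C₃) * ((1 + r * q) * C₄) * (C₅ * (1 - u / r * X)) *
          (F₆ * C₆) * (F₇ * C₇) /
        ((D₁ * (1 - q * X)) * ((1 - u ^ 2 * q) * D₂) * ((1 - q * u) * D₃) * ((1 + u) * D₄) *
          ((1 - r ^ 2 * q) * W) * (E₆ * D₆) * (E₇ * D₇)) * (X * q) =
    q * (1 - r * u * q) * (1 - r * u * q ^ 2) * F₆ * F₇ *
          (u - r ^ 2 * q + r - u / (r * q)) /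
        ((1 - u ^ 2) * (1 - u ^ 2 * q) * (1 - q * u) * (1 - r * q) * E₆ * E₇) *
      (R * C₂ * C₃ * C₄ * C₅ * C₆ * C₇ / (D₁ * D₂ * D₃ * D₄ * D₅ * D₆ * D₇) * X) := by
  have hN : (1 - r ^ 2 * q) * (1 - r * q * X) * (1 - u / (r * q)) * (1 - u * q * X) -
      (1 - r) * (1 - u / r * X) * (1 - u) * (1 - r ^ 2 * q ^ 2 * X) =
      (u - r ^ 2 * q + r - u / (r * q)) * (1 - q * X) * (1 - r * u * q * X) := by
    field_simp
    ring
  rw [show 1 - u ^ 2 = (1 - u) * (1 + u) by ring]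
  exact sub_eq_of_common_factors hα hR hU (by rw [hW]; ring) hN ha hqX hr2 hrq' hu1 huX hr2X

/-- Contiguous relation for the Andrews–Berkovich ${}_{10}\phi_9$ sums. -/
theorem andrews_berkovich_contiguous (q : ℂ) (hq : q ≠ 0) (n : ℕ) (hn : 1 ≤ n) (a u : ℂ)
    (ha : a ≠ 0) (hu : u ≠ 0) (ha1 : a ≠ 1)
    (h1 : qPoch q q n ≠ 0) (h2 : qPoch (q ^ 2) (u ^ 2 * q) (n + 1) ≠ 0)
    (h3 : qPoch (q ^ 2) (u ^ 2) (n + 1) ≠ 0) (h4 : qPoch q (q * u) (n + 1) ≠ 0)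
    (h5 : qPoch q (-u) (n + 1) ≠ 0) (h6 : qPoch q (a ^ 2 * q ^ 2 / u ^ 2) (n + 1) ≠ 0)
    (h7 : qPoch q (a ^ 2 * q / u ^ 2) (n + 1) ≠ 0)
    (h8 : qPoch q (a * q ^ (1 - (n : ℤ)) / u ^ 2) (n + 1) ≠ 0)
    (h9 : qPoch q (a * q ^ ((n : ℤ) - 1)) (n + 3) ≠ 0)
    (h10 : 1 - u ^ 2 ≠ 0) (h11 : 1 - u ^ 2 * q ≠ 0) (h12 : 1 - q * u ≠ 0)
    (h13 : 1 - a * q / u ≠ 0) :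
    A10 q a u n - B10 q a u n
      = q * (1 - a * q) * (1 - a * q ^ 2) * (1 - u ^ 2 * q ^ n) * (1 - q ^ (-(n : ℤ))) *
          (u - a ^ 2 * q / u ^ 2 + a / u - u ^ 2 / (a * q)) /
          ((1 - u ^ 2) * (1 - u ^ 2 * q) * (1 - q * u) * (1 - a * q / u) *
            (1 - a * q ^ (1 - (n : ℤ)) / u ^ 2) * (1 - a * q ^ (n + 1)))
          * B10 q (a * q ^ 2) (u * q) (n - 1) := by
  obtain ⟨m, rfl⟩ : ∃ m, n = m + 1 := ⟨n - 1, by omega⟩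
  obtain ⟨r, rfl⟩ : ∃ r, a = r * u := ⟨a / u, by field_simp⟩
  have hr : r ≠ 0 := left_ne_zero_of_mul ha
  have ey : q ^ (1 - ((m + 1 : ℕ) : ℤ)) = q ^ (-((m + 1 : ℕ) : ℤ)) * q := by
    rw [sub_eq_add_neg, add_comm, zpow_add_one₀ hq]
  have ey1 : q ^ (-(m : ℤ)) = q ^ (-((m + 1 : ℕ) : ℤ)) * q := by
    rw [← ey]; congr 1; push_cast; ring
  have ey2 : q ^ (1 - (m : ℤ)) = q ^ (-((m + 1 : ℕ) : ℤ)) * q * q := by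
    rw [← ey1, ← zpow_add_one₀ hq]; congr 1; ring
  have e1 : (r * u) ^ 2 * q / u ^ 2 = r ^ 2 * q := by field_simp
  have e2 : (r * u) ^ 2 * q ^ 2 / u ^ 2 = r ^ 2 * q ^ 2 := by field_simp
  have e3 : r * u * q / u = r * q := by field_simp
  have e4 : u ^ 2 / (r * u * q) = u / (r * q) := by field_simp
  have e5 : u ^ 2 / (r * u) = u / r := by field_simp
  have e6 : r * u / u = r := by field_simp
  have f1 : (r * u * q ^ 2) ^ 2 * q / (u * q) ^ 2 = r ^ 2 * q * q ^ 2 := by field_simp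
  have f3 : r * u * q ^ 2 * q / (u * q) = r * q * q := by field_simp
  have f5 : (u * q) ^ 2 / (r * u * q ^ 2) = u / r := by field_simp
  have f6 : r * u * q ^ 2 / (u * q) = r * q := by field_simp
  have f7 (y : ℂ) : r * u * q ^ 2 * (y * q * q) / (u * q) ^ 2 = r * u * (y * q) / u ^ 2 * q := by
    field_simp
  simp only [A10, B10, Nat.add_sub_cancel, ey, ey1, ey2, e1, e2, e3, e4, e5, e6, f1, f3, f5, f6,
    f7] at *
  rw [← Finset.sum_sub_distrib, Finset.sum_range_succ', Finset.mul_sum]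
  generalize hy : q ^ (-((m + 1 : ℕ) : ℤ)) = y at *
  have hu1 : 1 - u ≠ 0 := fun h => h10 (by linear_combination (1 + u) * h)
  have hb : 1 - r ^ 2 * q ^ 2 ≠ 0 := by
    simpa using one_sub_mul_pow_ne_zero h6 (Nat.succ_pos _)
  have hrq' : 1 + r * q ≠ 0 := fun h => hb (by linear_combination (1 - r * q) * h)
  rw [add_eq_left.mpr (by simp [qPoch])]
  refine Finset.sum_congr rfl fun i hi => ?_
  have hi : i < m + 1 := Finset.mem_range.mp hi
  have key := sub_eq_mul_shifted_term (q := q) (r := r) (u := u) (X := q ^ i)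
    (α := qPoch q (r * u) (i + 1)) (P := qPoch q (r * u * q ^ 2) i)
    (R := qPoch q (r * u * q ^ 2) i *
      ((1 - r * u * q ^ 2 * q ^ (2 * i)) / (1 - r * u * q ^ 2)))
    (C₂ := qPoch (q ^ 2) (r ^ 2 * q * q ^ 2) i) (C₃ := qPoch q (r * q) i)
    (C₄ := qPoch q (-(r * q * q)) i) (C₅ := qPoch q (u / r) i)
    (C₆ := qPoch q (u ^ 2 * q ^ (m + 1) * q) i) (C₇ := qPoch q (y * q) i)
    (D₁ := qPoch q q i) (D₂ := qPoch (q ^ 2) (u ^ 2 * q * q ^ 2) i)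
    (D₃ := qPoch q (q * u * q) i) (D₄ := qPoch q (-u * q) i)
    (D₅ := qPoch q (r ^ 2 * q ^ 2 * q) i) (D₆ := qPoch q (r * u * (y * q) / u ^ 2 * q) i)
    (D₇ := qPoch q (r * u * q ^ (m + 1 + 1) * q) i)
    (U := qPoch q u (i + 1)) (W := qPoch q (r ^ 2 * q ^ 2) i)
    (E₆ := 1 - r * u * (y * q) / u ^ 2) (E₇ := 1 - r * u * q ^ (m + 1 + 1))
    (F₆ := 1 - u ^ 2 * q ^ (m + 1)) (F₇ := 1 - y)
    hq hr (sub_ne_zero.mpr ha1.symm)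
    (by
      rw [show 1 - r * u * q * q ^ i = 1 - r * u * q ^ (i + 1) by ring, ← qPoch_succ,
        qPoch_succ_left, qPoch_succ_left]
      ring_nf)
    (by rw [one_sub_mul_qPoch_div]; ring)
    (by
      rw [show 1 - u * q * q ^ i = 1 - u * q ^ (i + 1) by ring, ← qPoch_succ,
        qPoch_succ_left, qPoch_succ_left]
      ring_nf)
    (by rw [← qPoch_succ, qPoch_succ_left])
    (one_sub_mul_pow_ne_zero h1 hi) hu1 hrq'
    (by simpa using one_sub_mul_pow_ne_zero h7 (Nat.succ_pos _))
    (one_sub_mul_pow_ne_zero h6 (by omega))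
    (by simpa [mul_comm u q] using one_sub_mul_pow_ne_zero h4 (show i < m + 1 + 1 by omega))
  have s₁ : qPoch (q ^ 2) (r ^ 2 * q ^ 2) (i + 1) =
      (qPoch q (r * q) i * (1 - r * q * q ^ i)) * ((1 + r * q) * qPoch q (-(r * q * q)) i) := by
    rw [show r ^ 2 * q ^ 2 = (r * q) ^ 2 by ring, qPoch_sq, qPoch_succ,
      qPoch_succ_left q (-(r * q))]
    ring_nf
  have s₂ : qPoch q (u / (r * q)) (i + 1) = (1 - u / (r * q)) * qPoch q (u / r) i := by
    rw [qPoch_succ_left]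
    congr 2
    field_simp
  have s₃ : qPoch (q ^ 2) (u ^ 2) (i + 1) =
      qPoch q u (i + 1) * ((1 + u) * qPoch q (-u * q) i) := by
    rw [qPoch_sq, qPoch_succ_left q (-u), sub_neg_eq_add]
  have s₄ : qPoch q (-(r * q)) (i + 1) = (1 + r * q) * qPoch q (-(r * q * q)) i := by
    rw [qPoch_succ_left, sub_neg_eq_add, neg_mul]
  have s₅ : qPoch q (-u) (i + 1) = (1 + u) * qPoch q (-u * q) i := by
    rw [qPoch_succ_left, sub_neg_eq_add]
  have s₆ : qPoch q (r ^ 2 * q) (i + 1) = (1 - r ^ 2 * q) * qPoch q (r ^ 2 * q ^ 2) i := by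
    rw [qPoch_succ_left]
    ring_nf
  have s₇ : 1 - r * u * q ^ (2 * (i + 1)) = 1 - r * u * q ^ 2 * (q ^ i) ^ 2 := by ring
  convert key using 1
  · rw [s₁, s₂, s₃, s₄, s₅, s₆, s₇, qPoch_succ q (r ^ 2 * q ^ 2), qPoch_succ q q,
      qPoch_succ q (u / r), qPoch_succ_left (q ^ 2) (r ^ 2 * q),
      qPoch_succ_left q (u ^ 2 * q ^ (m + 1)), qPoch_succ_left q y,
      qPoch_succ_left (q ^ 2) (u ^ 2 * q), qPoch_succ_left q (q * u),
      qPoch_succ_left q (r * u * (y * q) / u ^ 2),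
      qPoch_succ_left q (r * u * q ^ (m + 1 + 1)), qPoch_succ_left q r, pow_succ q i]
  · rw [show (u * q) ^ 2 * q = u ^ 2 * q * q ^ 2 by ring,
      show (u * q) ^ 2 * q ^ m = u ^ 2 * q ^ (m + 1) * q by ring,
      show q * (u * q) = q * u * q by ring, show -(u * q) = -u * q by ring,
      show r ^ 2 * q * q ^ 2 = r ^ 2 * q ^ 2 * q by ring,
      show r * u * q ^ 2 * q ^ (m + 1) = r * u * q ^ (m + 1 + 1) * q by ring]
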